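/- Let p, m, n ∈ ℕ with |n−m| ≤ p ≤ m+n, and let α ∈ ℝ with α > −1. Then ∫_{0}^{∞} L_p^α(x)·L_m^α(x)·L_n^α(x)·x^α e^{−x} dx = [Γ(α+1+max(m,n))·(−1)^{p+n+m}·2^{2·min(m,n)}·(1/2)_{min(m,n)}] / [|n−m|!·(m+n−p)!·(p−|n−m|)!] · ₃F₂(−α−min(m,n), (|n−m|−p)/2, (|n−m|−p+1)/2; 1+|n−m|, 1/2−min(m,n); 1). -/

import Mathlib

open MeasureTheory

/-- Pochhammer symbol `(a)_j` for real `a` and natural `j`. -/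
noncomputable def poch (a : ℝ) (j : ℕ) : ℝ := (ascPochhammer ℝ j).eval a

/-- Pochhammer symbol `(a)_j` for integer index, with the convention
`(a)_{-j} = 1/((a-1)(a-2)⋯(a-j))` for `j ≥ 1`. -/
noncomputable def pochZ (a : ℝ) (j : ℤ) : ℝ :=
  if 0 ≤ j then poch a j.toNat
  else (∏ i ∈ Finset.range (-j).toNat, (a - (i + 1)))⁻¹

/-- Factorial of an integer: `j!` for `j ≥ 0` and `0` for `j < 0`
(encoding `1/(negative integer)! = 0` via Lean's division by zero). -/
noncomputable def ifact (j : ℤ) : ℝ := if 0 ≤ j then (j.toNat.factorial : ℝ) else 0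

/-- Generalized hypergeometric sum `ᵣF_s(a; b; z)` (intended for terminating series,
where all terms beyond the termination index vanish). -/
noncomputable def hypSum (a b : List ℝ) (z : ℝ) : ℝ :=
  ∑' j : ℕ, ((a.map fun t => poch t j).prod /
    ((b.map fun t => poch t j).prod * (j.factorial : ℝ))) * z ^ j

/-- Laguerre polynomial `L_n^α(x)`. -/
noncomputable def lagL (α : ℝ) (n : ℕ) (x : ℝ) : ℝ :=
  ∑ k ∈ Finset.range (n + 1),
    (-1) ^ k * poch (α + k + 1) (n - k) / (((n - k).factorial : ℝ) * k.factorial) * x ^ k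

/-- The coefficient of `x ^ k` in `L_n^α`, written with Gamma functions. -/
noncomputable def lagCoeff (α : ℝ) (n k : ℕ) : ℝ :=
  (-1) ^ k * Real.Gamma (α + 1 + n) /
    (Real.Gamma (α + 1 + k) * ((n - k).factorial : ℝ) * k.factorial)

/-- The Laguerre polynomial as an element of `ℝ[X]`. -/
noncomputable def lagPoly (α : ℝ) (n : ℕ) : Polynomial ℝ :=
  ∑ k ∈ Finset.range (n + 1), Polynomial.monomial k (lagCoeff α n k)

/-- The moment functional `X ^ k ↦ Γ(α + 1 + k)` of the weight `x ^ α * exp (-x)`. -/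
noncomputable def lagMoment (α : ℝ) : Polynomial ℝ →ₗ[ℝ] ℝ :=
  Polynomial.lsum fun k => Real.Gamma (α + 1 + k) • LinearMap.id

/-- The linear map `X ^ k ↦ Γ(α + 1 + k) * (1 + X) ^ k`. -/
noncomputable def lagScaledMoment (α : ℝ) : Polynomial ℝ →ₗ[ℝ] Polynomial ℝ :=
  Polynomial.lsum fun k =>
    (LinearMap.toSpanSingleton ℝ (Polynomial ℝ)
      (Real.Gamma (α + 1 + k) • (1 + Polynomial.X : Polynomial ℝ) ^ k))

lemma lagMoment_monomial (α : ℝ) (k : ℕ) (c : ℝ) :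
    lagMoment α (Polynomial.monomial k c) = Real.Gamma (α + 1 + k) * c := by
  simp [lagMoment, Polynomial.lsum_apply, Polynomial.sum_monomial_index]

lemma lagScaledMoment_monomial (α : ℝ) (k : ℕ) (c : ℝ) :
    lagScaledMoment α (Polynomial.monomial k c) =
      (c * Real.Gamma (α + 1 + k)) • (1 + Polynomial.X : Polynomial ℝ) ^ k := by
  simp [lagScaledMoment, Polynomial.lsum_apply, Polynomial.sum_monomial_index, mul_smul]

lemma poch_zero (a : ℝ) : poch a 0 = 1 := by simp [poch]

lemma poch_succ (a : ℝ) (j : ℕ) : poch a (j + 1) = poch a j * (a + j) :=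
  ascPochhammer_succ_eval ..

lemma poch_succ_left (a : ℝ) (j : ℕ) : poch a (j + 1) = a * poch (a + 1) j := by
  simp [poch, ascPochhammer_succ_left]

lemma poch_add (a : ℝ) (k j : ℕ) : poch a (k + j) = poch a k * poch (a + k) j := by
  induction j with
  | zero => simp [poch_zero]
  | succ j ih => rw [← add_assoc, poch_succ, poch_succ, ih]; push_cast; ring

lemma poch_reflect (a : ℝ) (j : ℕ) : poch (1 - j - a) j = (-1) ^ j * poch a j := by
  induction j generalizing a with
  | zero => simp [poch_zero]
  | succ j ih =>
    rw [poch_succ, poch_succ_left a]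
    have h := ih (a + 1)
    rw [show (1 - ((j + 1 : ℕ) : ℝ) - a) = 1 - j - (a + 1) by push_cast; ring, h]
    ring

lemma Gamma_add_natCast {a : ℝ} (ha : 0 < a) (j : ℕ) :
    Real.Gamma (a + j) = Real.Gamma a * poch a j := by
  induction j with
  | zero => simp [poch_zero]
  | succ j ih =>
    rw [poch_succ, ← mul_assoc, ← ih, Nat.cast_succ, ← add_assoc,
      Real.Gamma_add_one (by positivity), mul_comm]

lemma poch_one_add_natCast (d j : ℕ) :
    poch (1 + d) j = ((d + j).factorial : ℝ) / d.factorial := by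
  have h := Gamma_add_natCast (a := (d : ℝ) + 1) (by positivity) j
  rw [Real.Gamma_nat_eq_factorial,
    show (d : ℝ) + 1 + j = ((d + j : ℕ) : ℝ) + 1 by push_cast; ring,
    Real.Gamma_nat_eq_factorial, add_comm (d : ℝ)] at h
  rw [h]; field_simp

lemma four_pow_mul_poch_half (M : ℕ) :
    2 ^ (2 * M) * poch (1 / 2) M = ((2 * M).factorial : ℝ) / M.factorial := by
  induction M with
  | zero => simp [poch_zero]
  | succ M ih =>
    rw [eq_div_iff (by positivity)] at ih ⊢
    rw [poch_succ, show 2 * (M + 1) = 2 * M + 1 + 1 by ring]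
    simp only [Nat.factorial_succ]
    push_cast
    rw [← ih]
    ring

lemma four_pow_mul_poch_mul_poch (n j : ℕ) :
    4 ^ j * (poch (-n / 2) j * poch ((-n + 1) / 2) j) = (n.descFactorial (2 * j) : ℝ) := by
  induction j with
  | zero => simp [poch_zero]
  | succ j ih =>
    rw [poch_succ, poch_succ, show 2 * (j + 1) = 2 * j + 1 + 1 by ring, Nat.descFactorial_succ,
      Nat.descFactorial_succ]
    have h : ((n - (2 * j + 1) : ℕ) : ℝ) * (((n - 2 * j : ℕ) : ℝ) * n.descFactorial (2 * j)) =
        (n - (2 * j + 1)) * ((n - 2 * j) * n.descFactorial (2 * j)) := by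
      rcases lt_or_ge n (2 * j) with hn | hn
      · simp [Nat.descFactorial_of_lt hn]
      · rcases hn.eq_or_lt with hn | hn
        · subst hn; simp
        · rw [Nat.cast_sub (by omega), Nat.cast_sub (by omega)]; push_cast; ring
    push_cast
    rw [h, ← ih]
    ring

lemma fwdDiff_iter_poch (k p : ℕ) (y : ℝ) :
    (fwdDiff (1 : ℝ))^[p] (fun y => poch y k) y = k.descFactorial p * poch (y + p) (k - p) := by
  induction p generalizing y with
  | zero => simp
  | succ p ih =>
    rw [Function.iterate_succ_apply', fwdDiff, ih, ih, Nat.descFactorial_succ]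
    rcases lt_or_ge p k with hp | hp
    · obtain ⟨r, rfl⟩ : ∃ r, k = p + r + 1 := ⟨k - p - 1, by omega⟩
      rw [show p + r + 1 - (p + 1) = r by omega, show p + r + 1 - p = r + 1 by omega,
        poch_succ_left (y + p), poch_succ]
      push_cast
      rw [show y + 1 + (p : ℝ) = y + p + 1 by ring, show y + ((p : ℝ) + 1) = y + p + 1 by ring]
      ring
    · simp [Nat.sub_eq_zero_of_le hp, poch_zero]

lemma lagMoment_lagPoly_mul_monomial {α : ℝ} (hα : -1 < α) (p k : ℕ) (c : ℝ) :
    lagMoment α (lagPoly α p * Polynomial.monomial k c) =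
      (-1) ^ p * (k.choose p * (c * Real.Gamma (α + 1 + k))) := by
  have hpos (i : ℕ) : 0 < Real.Gamma (α + 1 + i) :=
    Real.Gamma_pos_of_pos (by have := i.cast_nonneg (α := ℝ); linarith)
  have h := fwdDiff_iter_eq_sum_shift (1 : ℝ) (fun y => poch y k) p (α + 1)
  rw [fwdDiff_iter_poch] at h
  have hterm : ∀ i ∈ Finset.range (p + 1),
      lagMoment α (Polynomial.monomial i (lagCoeff α p i) * Polynomial.monomial k c) =
      (-1) ^ p * c * (Real.Gamma (α + 1 + p) / p.factorial) *
        (((-1 : ℤ) ^ (p - i) * (p.choose i : ℤ)) • poch (α + 1 + i • (1 : ℝ)) k) := by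
    intro i hi
    obtain ⟨r, rfl⟩ : ∃ r, p = i + r :=
      ⟨p - i, by have := Finset.mem_range.1 hi; omega⟩
    rw [Polynomial.monomial_mul_monomial, lagMoment_monomial, lagCoeff]
    have h1 := Gamma_add_natCast (a := α + 1 + i)
      (by have := i.cast_nonneg (α := ℝ); linarith) k
    have h2 : ((i + r).choose i : ℝ) = (i + r).factorial / (i.factorial * r.factorial) :=
      Nat.cast_add_choose ℝ
    have h3 : ((-1 : ℝ) ^ r) * (-1) ^ r = 1 := by rw [← mul_pow]; simp
    rw [show α + 1 + ((i + k : ℕ) : ℝ) = α + 1 + i + k by push_cast; ring, h1, zsmul_eq_mul,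
      add_tsub_cancel_left]
    push_cast
    rw [h2, nsmul_eq_mul, mul_one, pow_add]
    have := (hpos i).ne'
    field_simp
    linear_combination (-1) * poch (α + 1 + i) k * Real.Gamma (α + 1 + (i + r)) * c * h3
  rw [lagPoly, Finset.sum_mul, map_sum, Finset.sum_congr rfl hterm, ← Finset.mul_sum, ← h]
  rcases lt_or_ge k p with hk | hk
  · simp [Nat.choose_eq_zero_of_lt hk, Nat.descFactorial_of_lt hk]
  · obtain ⟨r, rfl⟩ := Nat.exists_eq_add_of_le hk
    have h1 := Gamma_add_natCast (a := α + 1 + p)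
      (by have := p.cast_nonneg (α := ℝ); linarith) r
    rw [show α + 1 + ((p + r : ℕ) : ℝ) = α + 1 + p + r by push_cast; ring, h1,
      Nat.descFactorial_eq_factorial_mul_choose, add_tsub_cancel_left]
    push_cast
    field_simp

lemma coeff_lagScaledMoment {α : ℝ} (hα : -1 < α) (p : ℕ) (q : Polynomial ℝ) :
    (lagScaledMoment α q).coeff p = (-1) ^ p * lagMoment α (lagPoly α p * q) := by
  induction q using Polynomial.induction_on' with
  | add q r hq hr => rw [mul_add, map_add, map_add, Polynomial.coeff_add, hq, hr, mul_add]
  | monomial k c =>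
    rw [lagMoment_lagPoly_mul_monomial hα, lagScaledMoment_monomial, Polynomial.coeff_smul,
      Polynomial.coeff_one_add_X_pow, ← mul_assoc, ← mul_pow]
    simp [mul_comm]

lemma eval_lagScaledMoment (α u : ℝ) (q : Polynomial ℝ) :
    (lagScaledMoment α q).eval u =
      lagMoment α (q.comp (Polynomial.C (1 + u) * Polynomial.X)) := by
  induction q using Polynomial.induction_on' with
  | add q r hq hr => rw [Polynomial.add_comp, map_add, map_add, Polynomial.eval_add, hq, hr]
  | monomial k c =>
    rw [lagScaledMoment_monomial, Polynomial.monomial_comp, mul_pow, ← Polynomial.C_pow,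
      ← mul_assoc, ← Polynomial.C_mul, Polynomial.C_mul_X_pow_eq_monomial, lagMoment_monomial]
    simp
    ring

lemma lagMoment_lagPoly_mul_lagPoly_of_le {α : ℝ} (hα : -1 < α) {k l : ℕ} (h : k ≤ l) :
    lagMoment α (lagPoly α l * lagPoly α k) =
      if k = l then Real.Gamma (α + 1 + k) / k.factorial else 0 := by
  nth_rw 2 [lagPoly]
  rw [Finset.mul_sum, map_sum]
  simp only [lagMoment_lagPoly_mul_monomial hα]
  rw [Finset.sum_range_succ, Finset.sum_eq_zero, zero_add]
  · split_ifs with hkl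
    · subst hkl
      have h3 : ((-1 : ℝ) ^ k) * (-1) ^ k = 1 := by rw [← mul_pow]; simp
      have : Real.Gamma (α + 1 + k) ≠ 0 :=
        (Real.Gamma_pos_of_pos (by have := k.cast_nonneg (α := ℝ); linarith)).ne'
      simp only [lagCoeff, Nat.choose_self, Nat.sub_self, Nat.factorial_zero]
      push_cast
      field_simp
      linear_combination h3
    · rw [Nat.choose_eq_zero_of_lt (by omega)]; simp
  · intro i hi
    rw [Nat.choose_eq_zero_of_lt (by have := Finset.mem_range.1 hi; omega)]; simp

lemma lagMoment_lagPoly_mul_lagPoly {α : ℝ} (hα : -1 < α) (k l : ℕ) :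
    lagMoment α (lagPoly α l * lagPoly α k) =
      if k = l then Real.Gamma (α + 1 + k) / k.factorial else 0 := by
  rcases le_total k l with h | h
  · exact lagMoment_lagPoly_mul_lagPoly_of_le hα h
  · rw [mul_comm, lagMoment_lagPoly_mul_lagPoly_of_le hα h]
    rcases eq_or_ne k l with rfl | hkl
    · rfl
    · simp [hkl, hkl.symm]

/-- The connection coefficient between `L_n^α` with scaled argument and `L_k^α`. -/
noncomputable def lagScale (α : ℝ) (n k : ℕ) : ℝ :=
  Real.Gamma (α + 1 + n) / (Real.Gamma (α + 1 + k) * ((n - k).factorial : ℝ))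

lemma coeff_lagPoly (α : ℝ) (n i : ℕ) :
    (lagPoly α n).coeff i = if i ≤ n then lagCoeff α n i else 0 := by
  simp [lagPoly, Polynomial.coeff_monomial]

lemma lagPoly_comp_C_mul_X {α : ℝ} (hα : -1 < α) (n : ℕ) (t : ℝ) :
    (lagPoly α n).comp (Polynomial.C t * Polynomial.X) =
      ∑ k ∈ Finset.range (n + 1), (t ^ k * (1 - t) ^ (n - k) * lagScale α n k) • lagPoly α k := by
  have hpos (i : ℕ) : Real.Gamma (α + 1 + i) ≠ 0 :=
    (Real.Gamma_pos_of_pos (by have := i.cast_nonneg (α := ℝ); linarith)).ne'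
  ext i
  rw [Polynomial.comp_C_mul_X_coeff, Polynomial.finsetSum_coeff]
  simp only [Polynomial.coeff_smul, coeff_lagPoly, smul_eq_mul]
  split_ifs with hi
  · obtain ⟨r, rfl⟩ := Nat.exists_eq_add_of_le hi
    rw [add_assoc, Finset.sum_range_add, Finset.sum_eq_zero, zero_add]
    · have hb := add_pow t (1 - t) r
      rw [add_sub_cancel, one_pow] at hb
      calc lagCoeff α (i + r) i * t ^ i
        _ = lagCoeff α (i + r) i * t ^ i *
            ∑ j ∈ Finset.range (r + 1), t ^ j * (1 - t) ^ (r - j) * (r.choose j : ℝ) := by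
          rw [← hb, mul_one]
        _ = _ := by
          rw [Finset.mul_sum]
          refine Finset.sum_congr rfl fun j hj => ?_
          obtain ⟨s, rfl⟩ : ∃ s, r = j + s :=
            ⟨r - j, by have := Finset.mem_range.1 hj; omega⟩
          have h2 : ((j + s).choose j : ℝ) = (j + s).factorial / (j.factorial * s.factorial) :=
      Nat.cast_add_choose ℝ
          rw [if_pos (by omega), h2, lagScale, lagCoeff, lagCoeff,
            show i + (j + s) - i = j + s by omega, show i + j - i = j by omega,
            show i + (j + s) - (i + j) = s by omega, show j + s - j = s by omega]
          have h3 := hpos i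
          have h4 := hpos (i + j)
          have h5 := hpos (i + (j + s))
          field_simp
          ring
    · intro k hk
      rw [if_neg (by have := Finset.mem_range.1 hk; omega), mul_zero]
  · rw [zero_mul, Finset.sum_eq_zero]
    intro k hk
    rw [if_neg (by have := Finset.mem_range.1 hk; omega), mul_zero]

lemma lagScaledMoment_lagPoly_mul_lagPoly {α : ℝ} (hα : -1 < α) {M N : ℕ} (h : M ≤ N) :
    lagScaledMoment α (lagPoly α M * lagPoly α N) =
      ∑ k ∈ Finset.range (M + 1), (Real.Gamma (α + 1 + k) / k.factorial *
        lagScale α M k * lagScale α N k * (-1) ^ (M + N)) •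
          ((1 + Polynomial.X : Polynomial ℝ) ^ (2 * k) * Polynomial.X ^ (M + N - 2 * k)) := by
  refine Polynomial.funext fun u => ?_
  rw [eval_lagScaledMoment, Polynomial.mul_comp, lagPoly_comp_C_mul_X hα,
    lagPoly_comp_C_mul_X hα, Finset.sum_mul_sum, map_sum, Polynomial.eval_finsetSum]
  refine Finset.sum_congr rfl fun k hk => ?_
  rw [map_sum]
  simp only [smul_mul_smul_comm, map_smul, lagMoment_lagPoly_mul_lagPoly hα, smul_eq_mul,
    mul_ite, mul_zero]
  rw [Finset.sum_ite_eq', if_pos (by have := Finset.mem_range.1 hk; simp; omega)]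
  obtain ⟨j, rfl⟩ : ∃ j, M = k + j := ⟨M - k, by have := Finset.mem_range.1 hk; omega⟩
  obtain ⟨d, rfl⟩ := Nat.exists_eq_add_of_le h
  rw [show k + j + (k + j + d) - 2 * k = j + (j + d) by omega,
    show k + j - k = j by omega, show k + j + d - k = j + d by omega,
    show 1 - (1 + u) = -1 * u by ring]
  have h3 : ((-1 : ℝ) ^ k) * (-1) ^ k = 1 := by rw [← mul_pow]; simp
  simp only [Polynomial.eval_smul, Polynomial.eval_mul, Polynomial.eval_pow, Polynomial.eval_add,
    Polynomial.eval_one, Polynomial.eval_X, smul_eq_mul, mul_pow, pow_add, two_mul]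
  rw [show ∀ a b : ℝ, (-1 : ℝ) ^ k * a * ((-1) ^ k * a * b) = a * a * b by
    intro a b; linear_combination a * a * b * h3]
  ring

lemma lagMoment_lagPoly_triple {α : ℝ} (hα : -1 < α) {M N : ℕ} (h : M ≤ N) (p : ℕ) :
    lagMoment α (lagPoly α p * (lagPoly α M * lagPoly α N)) =
      ∑ k ∈ Finset.range (M + 1), Real.Gamma (α + 1 + k) / k.factorial *
        lagScale α M k * lagScale α N k * (-1) ^ (p + M + N) *
          (if M + N - 2 * k ≤ p then ((2 * k).choose (p - (M + N - 2 * k)) : ℝ) else 0) := by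
  have h1 := coeff_lagScaledMoment hα p (lagPoly α M * lagPoly α N)
  have h3 : ((-1 : ℝ) ^ p) * (-1) ^ p = 1 := by rw [← mul_pow]; simp
  have h2 : lagMoment α (lagPoly α p * (lagPoly α M * lagPoly α N)) =
      (-1) ^ p * (lagScaledMoment α (lagPoly α M * lagPoly α N)).coeff p := by
    rw [h1, ← mul_assoc ((-1) ^ p), h3, one_mul]
  rw [h2, lagScaledMoment_lagPoly_mul_lagPoly hα h, Polynomial.finsetSum_coeff, Finset.mul_sum]
  refine Finset.sum_congr rfl fun k _ => ?_
  rw [Polynomial.coeff_smul, Polynomial.coeff_mul_X_pow', Polynomial.coeff_one_add_X_pow,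
    smul_eq_mul, pow_add, pow_add, pow_add]
  ring

lemma eval_lagPoly {α : ℝ} (hα : -1 < α) (n : ℕ) (x : ℝ) :
    (lagPoly α n).eval x = lagL α n x := by
  rw [lagPoly, lagL, Polynomial.eval_finsetSum]
  refine Finset.sum_congr rfl fun k hk => ?_
  obtain ⟨r, rfl⟩ : ∃ r, n = k + r := ⟨n - k, by have := Finset.mem_range.1 hk; omega⟩
  have hk0 : 0 < α + 1 + k := by have := k.cast_nonneg (α := ℝ); linarith
  have hpos := (Real.Gamma_pos_of_pos hk0).ne'
  have h1 := Gamma_add_natCast hk0 r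
  rw [Polynomial.eval_monomial, lagCoeff, show α + 1 + ((k + r : ℕ) : ℝ) = α + 1 + k + r by
    push_cast; ring, h1, show α + (k : ℝ) + 1 = α + 1 + k by ring, add_tsub_cancel_left]
  field_simp

lemma integrableOn_eval_and_integral_eval {α : ℝ} (hα : -1 < α) (q : Polynomial ℝ) :
    IntegrableOn (fun x => q.eval x * x ^ α * Real.exp (-x)) (Set.Ioi 0) ∧
      ∫ x in Set.Ioi (0 : ℝ), q.eval x * x ^ α * Real.exp (-x) = lagMoment α q := by
  induction q using Polynomial.induction_on' with
  | add q r hq hr =>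
    simp only [Polynomial.eval_add, add_mul]
    exact ⟨hq.1.add hr.1, by rw [integral_add hq.1 hr.1, hq.2, hr.2, map_add]⟩
  | monomial k c =>
    have hk0 : 0 < α + 1 + k := by have := k.cast_nonneg (α := ℝ); linarith
    have hfun : Set.EqOn (fun x : ℝ => c * (Real.exp (-x) * x ^ (α + 1 + k - 1)))
        (fun x => (Polynomial.monomial k c).eval x * x ^ α * Real.exp (-x)) (Set.Ioi 0) := by
      intro x hx
      have hx : 0 < x := hx
      simp only [Polynomial.eval_monomial]
      rw [show α + 1 + k - 1 = α + k by ring, Real.rpow_add_natCast hx.ne']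
      ring
    refine ⟨IntegrableOn.congr_fun ((Real.GammaIntegral_convergent hk0).const_mul c) hfun
      measurableSet_Ioi, ?_⟩
    rw [← setIntegral_congr_fun measurableSet_Ioi hfun, integral_const_mul,
      ← Real.Gamma_eq_integral hk0, lagMoment_monomial, mul_comm]

lemma triple_term_eq {α : ℝ} (hα : -1 < α) (d k j p : ℕ) (h1 : d ≤ p)
    (h2 : p ≤ 2 * (k + j) + d) :
    Real.Gamma (α + 1 + (k + j + d : ℕ)) * 2 ^ (2 * (k + j)) * poch (1 / 2) (k + j) /
        ((d.factorial : ℝ) * ((2 * (k + j) + d - p).factorial : ℝ) * ((p - d).factorial : ℝ)) *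
      (poch (-α - (k + j : ℕ)) j * (poch ((d - p) / 2) j * poch ((d - p + 1) / 2) j) /
        (poch (1 + d) j * poch (1 / 2 - (k + j : ℕ)) j * j.factorial)) =
    Real.Gamma (α + 1 + k) / k.factorial * lagScale α (k + j) k * lagScale α (k + j + d) k *
      (if d + 2 * j ≤ p then ((2 * k).choose (p - (d + 2 * j)) : ℝ) else 0) := by
  obtain ⟨n, rfl⟩ := Nat.exists_eq_add_of_le h1
  have hn := four_pow_mul_poch_mul_poch n j
  rw [show (-n : ℝ) = d - (d + n : ℕ) by push_cast; ring] at hn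
  have hn' : poch ((d - (d + n : ℕ)) / 2) j * poch ((d - (d + n : ℕ) + 1) / 2) j =
      (n.descFactorial (2 * j) : ℝ) / 4 ^ j := by
    rw [← hn]; field_simp
  rw [hn']
  split_ifs with hj
  · obtain ⟨r, rfl⟩ : ∃ r, n = 2 * j + r := ⟨n - 2 * j, by omega⟩
    obtain ⟨s, hs⟩ : ∃ s, 2 * k = r + s := ⟨2 * k - r, by omega⟩
    have hk0 : 0 < α + 1 + k := by have := k.cast_nonneg (α := ℝ); linarith
    have hpos (i : ℕ) : Real.Gamma (α + 1 + i) ≠ 0 :=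
      (Real.Gamma_pos_of_pos (by have := i.cast_nonneg (α := ℝ); linarith)).ne'
    have hg := Gamma_add_natCast hk0 j
    have hr1 := poch_reflect (α + 1 + k) j
    have hr2 := poch_reflect (1 / 2 + k) j
    have hhalf := poch_add (1 / 2) k j
    have h4 := four_pow_mul_poch_half k
    have h4' := four_pow_mul_poch_half (k + j)
    have hdf : ((2 * j + r).descFactorial (2 * j) : ℝ) = (2 * j + r).factorial / r.factorial := by
      have := Nat.factorial_mul_descFactorial (n := 2 * j + r) (k := 2 * j) (by omega)
      rw [add_tsub_cancel_left] at this
      rw [← this]; push_cast; field_simp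
    have hc : ((r + s).choose r : ℝ) = (r + s).factorial / (r.factorial * s.factorial) :=
      Nat.cast_add_choose ℝ
    have hne : poch (1 / 2) (k + j) ≠ 0 := by
      intro h0
      rw [h0, mul_zero] at h4'
      exact (by positivity : ((2 * (k + j)).factorial : ℝ) / (k + j).factorial ≠ 0) h4'.symm
    have hne1 : poch (1 / 2) k ≠ 0 := fun h0 => hne (by rw [hhalf, h0, zero_mul])
    have hne2 : poch (1 / 2 + k) j ≠ 0 := fun h0 => hne (by rw [hhalf, h0, mul_zero])
    rw [show -α - ((k + j : ℕ) : ℝ) = 1 - j - (α + 1 + k) by push_cast; ring, hr1,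
      show 1 / 2 - ((k + j : ℕ) : ℝ) = 1 - j - (1 / 2 + k) by push_cast; ring, hr2,
      poch_one_add_natCast, hdf, hhalf, show d + (2 * j + r) - (d + 2 * j) = r by omega,
      show 2 * (k + j) + d - (d + (2 * j + r)) = s by omega,
      show d + (2 * j + r) - d = 2 * j + r by omega, hs, hc, lagScale, lagScale,
      show k + j - k = j by omega, show k + j + d - k = d + j by omega,
      show α + 1 + ((k + j : ℕ) : ℝ) = α + 1 + k + j by push_cast; ring, hg, ← hs]
    have h5 := hpos k
    have h6 := hpos (k + j + d)
    have h7 : (2 : ℝ) ^ (2 * (k + j)) = 2 ^ (2 * k) * 4 ^ j := by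
      rw [mul_add, pow_add, pow_mul 2 2 j]; norm_num
    rw [eq_div_iff (by positivity)] at h4
    rw [h7, ← h4]
    generalize poch (1 / 2 + k) j = v at *
    field_simp
  · rw [Nat.descFactorial_of_lt (by omega)]
    simp

lemma integral_lagL_triple_of_le {α : ℝ} (hα : -1 < α) {M N p : ℕ} (h : M ≤ N)
    (h1 : N - M ≤ p) (h2 : p ≤ M + N) :
    (∫ x in Set.Ioi (0 : ℝ),
        lagL α p x * (lagL α M x * lagL α N x) * x ^ α * Real.exp (-x)) =
      Real.Gamma (α + 1 + N) * (-1) ^ (p + M + N) * 2 ^ (2 * M) * poch (1 / 2) M /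
          (((N - M).factorial : ℝ) * ((M + N - p).factorial : ℝ) *
            ((p - (N - M)).factorial : ℝ)) *
        hypSum [-α - M, (((N - M : ℕ) : ℝ) - p) / 2, (((N - M : ℕ) : ℝ) - p + 1) / 2]
          [1 + ((N - M : ℕ) : ℝ), 1 / 2 - M] 1 := by
  have hint := (integrableOn_eval_and_integral_eval hα
    (lagPoly α p * (lagPoly α M * lagPoly α N))).2
  simp only [Polynomial.eval_mul, eval_lagPoly hα] at hint
  rw [hint, lagMoment_lagPoly_triple hα h, hypSum, tsum_eq_sum (s := Finset.range (M + 1)),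
    ← Finset.sum_range_reflect, Finset.mul_sum]
  · refine Finset.sum_congr rfl fun j hj => ?_
    obtain ⟨k, rfl⟩ : ∃ k, M = k + j := ⟨M - j, by have := Finset.mem_range.1 hj; omega⟩
    obtain ⟨d, rfl⟩ := Nat.exists_eq_add_of_le h
    have key := triple_term_eq hα d k j p (by omega) (by omega)
    rw [show k + j + 1 - 1 - j = k by omega, show k + j + d - (k + j) = d by omega,
      show k + j + (k + j + d) - 2 * k = d + 2 * j by omega]
    rw [show 2 * (k + j) + d - p = k + j + (k + j + d) - p by omega] at key
    simp only [List.map_cons, List.map_nil, List.prod_cons, List.prod_nil, mul_one, one_pow]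
    linear_combination (-1) * (-1) ^ (p + (k + j) + (k + j + d)) * key
  · intro j hj
    have hj : M < j := by simpa [Nat.lt_succ_iff] using hj
    obtain ⟨n, rfl⟩ := Nat.exists_eq_add_of_le h1
    have hn := four_pow_mul_poch_mul_poch n j
    rw [Nat.descFactorial_of_lt (by omega),
      show (-n : ℝ) = (N - M : ℕ) - ((N - M + n : ℕ) : ℝ) by push_cast; ring] at hn
    have hn' := (mul_eq_zero.1 (hn.trans Nat.cast_zero)).resolve_left (by positivity)
    simp only [List.map_cons, List.map_nil, List.prod_cons, List.prod_nil, mul_one, hn']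
    simp

theorem stmt15 (p m n : ℕ) (α : ℝ) (hα : -1 < α)
    (h1 : ((n : ℤ) - m).natAbs ≤ p) (h2 : p ≤ m + n) :
    (∫ x in Set.Ioi (0 : ℝ),
        lagL α p x * lagL α m x * lagL α n x * x ^ α * Real.exp (-x)) =
      Real.Gamma (α + 1 + (max m n : ℝ)) * (-1) ^ (p + n + m) * 2 ^ (2 * min m n) *
          poch (1 / 2) (min m n) /
          (((((n : ℤ) - m).natAbs.factorial : ℝ)) * ((m + n - p).factorial : ℝ) *
            (((p - ((n : ℤ) - m).natAbs).factorial : ℝ))) *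
        hypSum
          [-α - (min m n : ℝ), ((((n : ℤ) - m).natAbs : ℝ) - p) / 2,
            ((((n : ℤ) - m).natAbs : ℝ) - p + 1) / 2]
          [1 + ((((n : ℤ) - m).natAbs : ℝ)), 1 / 2 - (min m n : ℝ)] 1 := by
  rcases le_total m n with h | h
  · have hd : ((n : ℤ) - m).natAbs = n - m := by omega
    have key := integral_lagL_triple_of_le hα h (by omega) h2
    rw [hd, max_eq_right (Nat.cast_le.2 h), min_eq_left h,
      min_eq_left (Nat.cast_le.2 h)]
    rw [add_right_comm p m n] at key
    simpa only [mul_assoc] using key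
  · have hd : ((n : ℤ) - m).natAbs = m - n := by omega
    have key := integral_lagL_triple_of_le (p := p) hα h (by omega) (by omega)
    rw [hd, max_eq_left (Nat.cast_le.2 h), min_eq_right h,
      min_eq_right (Nat.cast_le.2 h)]
    rw [add_comm n m] at key
    simpa only [mul_assoc, mul_left_comm (lagL α m _) (lagL α n _)] using key
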